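/- Let A and B be C*-algebras, τ a faithful trace on B, and F : A → B a linear map. Then F is completely positive if and only if ω_τ(F)(x* x) is a nonnegative real number for every x in the algebraic tensor product A ⊗ Bᵐᵒᵖ, where the star operation on A ⊗ Bᵐᵒᵖ is determined by (a ⊗ bᵒᵖ)* = a* ⊗ (b*)ᵒᵖ. -/

import Mathlib

open scoped TensorProduct ComplexOrder
open MulOpposite

/-- A linear map `F : A → B` between C*-algebras is completely positive if for every `n`,
the induced map `M_n(A) → M_n(B)` (applying `F` entrywise) maps positive elements to
positive elements, positivity meaning being of the form `y⋆ * y`. -/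
def IsCompletelyPositive {A B : Type*} [NonUnitalCStarAlgebra A] [NonUnitalCStarAlgebra B]
    (F : A →ₗ[ℂ] B) : Prop :=
  ∀ (n : ℕ) (M : Matrix (Fin n) (Fin n) A),
    (∃ Y : Matrix (Fin n) (Fin n) A, M = star Y * Y) →
    ∃ Z : Matrix (Fin n) (Fin n) B, M.map F = star Z * Z

/-- The Choi–Jamiolkowski functional `ω_τ(F)` on the algebraic tensor product `A ⊗ Bᵐᵒᵖ`,
determined by `ω_τ(F)(a ⊗ bᵒᵖ) = τ (F a * b)`. -/
noncomputable def omega {A B : Type*} [NonUnitalCStarAlgebra A] [NonUnitalCStarAlgebra B]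
    (τ : B →ₗ[ℂ] ℂ) (F : A →ₗ[ℂ] B) : A ⊗[ℂ] Bᵐᵒᵖ →ₗ[ℂ] ℂ :=
  τ ∘ₗ (LinearMap.mul' ℂ B) ∘ₗ
    (TensorProduct.map F ((opLinearEquiv ℂ (M := B)).symm.toLinearMap))

/-- The star operation on `A ⊗ Bᵐᵒᵖ` determined by `(a ⊗ bᵒᵖ)⋆ = a⋆ ⊗ (b⋆)ᵒᵖ`. -/
noncomputable def tensorStar (A B : Type*) [NonUnitalCStarAlgebra A] [NonUnitalCStarAlgebra B] :
    A ⊗[ℂ] Bᵐᵒᵖ →+ A ⊗[ℂ] Bᵐᵒᵖ :=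
  TensorProduct.liftAddHom
    (AddMonoidHom.mk'
      (fun a => AddMonoidHom.mk' (fun b => star a ⊗ₜ[ℂ] star b)
        (fun b₁ b₂ => by simp [star_add, TensorProduct.tmul_add]))
      (fun a₁ a₂ => AddMonoidHom.ext fun b => by simp [star_add, TensorProduct.add_tmul]))
    (fun c a b =>
      show star (c • a) ⊗ₜ[ℂ] star b = star a ⊗ₜ[ℂ] star (c • b) by
        have hb : star (c • b) = star c • star b :=
          MulOpposite.unop_injective (by simp [star_smul])
        rw [star_smul, hb, TensorProduct.smul_tmul])

/-- If `φ` is a faithful positive linear functional on a C⋆-algebra, then an element `N` with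
`0 ≤ φ (X⋆ * N * X)` for every `X` is nonnegative, provided it is selfadjoint. -/
theorem IsSelfAdjoint.nonneg_of_faithful_conjugate_nonneg {C : Type*} [NonUnitalCStarAlgebra C]
    [PartialOrder C] [StarOrderedRing C] (φ : C →ₚ[ℂ] ℂ)
    (hφ : ∀ x : C, φ (star x * x) = 0 → x = 0) {N : C} (hN : IsSelfAdjoint N)
    (h : ∀ X : C, 0 ≤ φ (star X * N * X)) : 0 ≤ N := by
  rw [← CFC.negPart_eq_zero_iff N hN]
  have hneg : 0 ≤ N⁻ := CFC.negPart_nonneg N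
  obtain ⟨y, hy⟩ := CStarAlgebra.nonneg_iff_eq_star_mul_self.mp hneg
  have hsa : star N⁻ = N⁻ := hneg.isSelfAdjoint.star_eq
  have hcube : star N⁻ * N * N⁻ = -(star (y * N⁻) * (y * N⁻)) := by
    calc star N⁻ * N * N⁻ = N⁻ * (N⁺ - N⁻) * N⁻ := by rw [CFC.posPart_sub_negPart N hN, hsa]
      _ = -(N⁻ * N⁻ * N⁻) := by
        rw [mul_sub, CFC.negPart_mul_posPart, zero_sub, neg_mul]
      _ = -(N⁻ * (star y * y) * N⁻) := by rw [← hy]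
      _ = -(star (y * N⁻) * (y * N⁻)) := by rw [star_mul, hsa]; simp only [mul_assoc]
  have hle := h N⁻
  rw [hcube, map_neg, neg_nonneg] at hle
  have hzero : y * N⁻ = 0 := hφ _ (hle.antisymm (φ.map_nonneg (star_mul_self_nonneg _)))
  have hsq : star N⁻ * N⁻ = 0 := by
    rw [hsa]
    nth_rewrite 1 [hy]
    rw [mul_assoc, hzero, mul_zero]
  exact CStarRing.star_mul_self_eq_zero_iff _ |>.mp hsq

/-- If `ψ` is a faithful positive linear functional on a C⋆-algebra, then every element `N` with
`0 ≤ ψ (X⋆ * N * X)` for every `X` is of the form `Z⋆ * Z`. -/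
theorem CStarAlgebra.exists_eq_star_mul_self_of_faithful {C : Type*} [NonUnitalCStarAlgebra C]
    (ψ : C →ₗ[ℂ] ℂ) (hψ_pos : ∀ x : C, 0 ≤ ψ (star x * x))
    (hψ : ∀ x : C, ψ (star x * x) = 0 → x = 0) {N : C}
    (hN : ∀ X : C, 0 ≤ ψ (star X * N * X)) : ∃ Z : C, N = star Z * Z := by
  let _ : PartialOrder C := CStarAlgebra.spectralOrder C
  have : StarOrderedRing C := CStarAlgebra.spectralOrderedRing C
  obtain ⟨φ, hφψ⟩ : ∃ φ : C →ₚ[ℂ] ℂ, ∀ x, φ x = ψ x :=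
    ⟨.mk₀ ψ fun x hx => by
      obtain ⟨y, rfl⟩ := CStarAlgebra.nonneg_iff_eq_star_mul_self.mp hx
      exact hψ_pos y, fun _ => rfl⟩
  have hφ : ∀ x : C, φ (star x * x) = 0 → x = 0 := by simpa only [hφψ] using hψ
  have h : ∀ X : C, 0 ≤ φ (star X * N * X) := by simpa only [hφψ] using hN
  have hstar (X : C) : φ (star X * star N * X) = φ (star X * N * X) := by
    have hX : star X * star N * X = star (star X * N * X) := by simp [mul_assoc]
    rw [hX, map_star φ, (h X).star_eq]
  have hE : IsSelfAdjoint (Complex.I • (N - star N)) := by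
    simp [isSelfAdjoint_iff, star_smul, ← smul_neg]
  have hE0 (X : C) : φ (star X * (Complex.I • (N - star N)) * X) = 0 := by
    rw [mul_smul_comm, smul_mul_assoc, map_smul, mul_sub, sub_mul, map_sub, hstar, sub_self,
      smul_zero]
  have hpos := hE.nonneg_of_faithful_conjugate_nonneg φ hφ fun X => (hE0 X).ge
  have hneg := hE.neg.nonneg_of_faithful_conjugate_nonneg φ hφ fun X => by
    rw [mul_neg, neg_mul, map_neg, hE0, neg_zero]
  have hsub : N - star N = 0 :=
    (smul_eq_zero.mp ((neg_nonneg.mp hneg).antisymm hpos)).resolve_left Complex.I_ne_zero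
  exact CStarAlgebra.nonneg_iff_eq_star_mul_self.mp <|
    IsSelfAdjoint.nonneg_of_faithful_conjugate_nonneg φ hφ (sub_eq_zero.mp hsub).symm h

section CStarMatrix

variable {B n : Type*} [NonUnitalCStarAlgebra B] [Fintype n]

/-- The linear functional `X ↦ ∑ i, τ (X i i)` on matrices over `B`. -/
noncomputable def CStarMatrix.traceFunctional (τ : B →ₗ[ℂ] ℂ) : CStarMatrix n n B →ₗ[ℂ] ℂ where
  toFun X := ∑ i, τ (X i i)
  map_add' X Y := by simp [Finset.sum_add_distrib]
  map_smul' c X := by simp [Finset.mul_sum]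

theorem CStarMatrix.traceFunctional_star_mul_mul (τ : B →ₗ[ℂ] ℂ) (N X : CStarMatrix n n B) :
    traceFunctional τ (star X * N * X) =
      ∑ k, ∑ i, ∑ j, τ (star (X i k) * N i j * X j k) := by
  refine Finset.sum_congr rfl fun k _ => ?_
  simp only [CStarMatrix.mul_apply, CStarMatrix.star_apply, Finset.sum_mul, map_sum]
  exact Finset.sum_comm

theorem CStarMatrix.traceFunctional_star_mul_self (τ : B →ₗ[ℂ] ℂ) (X : CStarMatrix n n B) :
    traceFunctional τ (star X * X) = ∑ k, ∑ i, τ (star (X i k) * X i k) := by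
  refine Finset.sum_congr rfl fun k _ => ?_
  simp only [CStarMatrix.mul_apply, CStarMatrix.star_apply, map_sum]

/-- A matrix `N` over a C⋆-algebra with a faithful positive functional `τ` is of the form `Z⋆ * Z`
as soon as `∑ i j, τ (b i⋆ * N i j * b j)` is nonnegative for every vector `b`. -/
theorem Matrix.exists_eq_star_mul_self_of_faithful (τ : B →ₗ[ℂ] ℂ)
    (hτ_pos : ∀ b : B, 0 ≤ τ (star b * b)) (hτ_faithful : ∀ b : B, τ (star b * b) = 0 → b = 0)
    (N : Matrix n n B) (h : ∀ b : n → B, 0 ≤ ∑ i, ∑ j, τ (star (b i) * N i j * b j)) :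
    ∃ Z : Matrix n n B, N = star Z * Z := by
  let _ : PartialOrder B := CStarAlgebra.spectralOrder B
  have : StarOrderedRing B := CStarAlgebra.spectralOrderedRing B
  refine CStarAlgebra.exists_eq_star_mul_self_of_faithful (N := CStarMatrix.ofMatrix N)
    (CStarMatrix.traceFunctional τ) (fun X => ?_) (fun X hX => ?_) (fun X => ?_)
  · rw [CStarMatrix.traceFunctional_star_mul_self]
    exact Finset.sum_nonneg fun _ _ => Finset.sum_nonneg fun _ _ => hτ_pos _
  · rw [CStarMatrix.traceFunctional_star_mul_self] at hX
    ext i k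
    have hk := (Finset.sum_eq_zero_iff_of_nonneg fun _ _ =>
      Finset.sum_nonneg fun _ _ => hτ_pos _).mp hX k (Finset.mem_univ k)
    exact hτ_faithful _ <| (Finset.sum_eq_zero_iff_of_nonneg fun _ _ => hτ_pos _).mp hk i
      (Finset.mem_univ i)
  · rw [CStarMatrix.traceFunctional_star_mul_mul]
    exact Finset.sum_nonneg fun k _ => h fun i => X i k

end CStarMatrix

/-- The value of `ω_τ(F)` at `x⋆ * x` for `x = ∑ i, a i ⊗ (b i)ᵒᵖ`. -/
theorem omega_tensorStar_mul_self {A B ι : Type*} [NonUnitalCStarAlgebra A]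
    [NonUnitalCStarAlgebra B] [Fintype ι] (τ : B →ₗ[ℂ] ℂ)
    (hτ_tracial : ∀ b c : B, τ (b * c) = τ (c * b)) (F : A →ₗ[ℂ] B) (a : ι → A) (b : ι → B) :
    omega τ F (tensorStar A B (∑ i, a i ⊗ₜ[ℂ] op (b i)) * ∑ i, a i ⊗ₜ[ℂ] op (b i)) =
      ∑ i, ∑ j, τ (star (b i) * F (star (a i) * a j) * b j) := by
  have hstar (c : A) (d : B) : tensorStar A B (c ⊗ₜ[ℂ] op d) = star c ⊗ₜ[ℂ] op (star d) := rfl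
  simp only [map_sum, hstar, Finset.sum_mul_sum, Algebra.TensorProduct.tmul_mul_tmul]
  refine Finset.sum_congr rfl fun i _ => Finset.sum_congr rfl fun j _ => ?_
  rw [mul_assoc (star (b i)), hτ_tracial (star (b i)), mul_assoc]
  rfl

/-- Let `A` and `B` be C*-algebras, `τ` a faithful trace on `B` and
`F : A → B` a linear map.  Then `F` is completely positive if and only if
`ω_τ(F)(x⋆ x) ≥ 0` for every `x` in the algebraic tensor product `A ⊗ Bᵐᵒᵖ`. -/
theorem isCompletelyPositive_iff_omega_pos
    (A B : Type*) [NonUnitalCStarAlgebra A] [NonUnitalCStarAlgebra B]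
    (τ : B →ₗ[ℂ] ℂ) (hτ_ne : τ ≠ 0)
    (hτ_pos : ∀ b : B, 0 ≤ τ (star b * b))
    (hτ_tracial : ∀ b c : B, τ (b * c) = τ (c * b))
    (hτ_faithful : ∀ b : B, τ (star b * b) = 0 → b = 0)
    (F : A →ₗ[ℂ] B) :
    IsCompletelyPositive F ↔
      ∀ x : A ⊗[ℂ] Bᵐᵒᵖ, 0 ≤ omega τ F (tensorStar A B x * x) := by
  constructor
  · intro hF x
    obtain ⟨k, a, b, rfl⟩ := TensorProduct.exists_sum_tmul_eq x
    change 0 ≤ omega τ F (tensorStar A B (∑ i, a i ⊗ₜ[ℂ] op (unop (b i))) *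
      ∑ i, a i ⊗ₜ[ℂ] op (unop (b i)))
    rw [omega_tensorStar_mul_self τ hτ_tracial]
    obtain ⟨Z, hZ⟩ : ∃ Z : Matrix (Fin k) (Fin k) B,
        (Matrix.of fun i j => F (star (a i) * a j)) = star Z * Z := by
      rcases k with - | k
      · exact ⟨0, Subsingleton.elim _ _⟩
      · refine hF (k + 1) (Matrix.of fun i j => star (a i) * a j)
          ⟨Matrix.of fun i j => if i = 0 then a j else 0, ?_⟩
        ext i j
        simp [Matrix.mul_apply, apply_ite star]
    have hentry (i j : Fin k) : F (star (a i) * a j) = ∑ l, star (Z l i) * Z l j := by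
      simpa [Matrix.mul_apply] using congr_fun₂ hZ i j
    have hsum : ∑ i, ∑ j, τ (star (unop (b i)) * F (star (a i) * a j) * unop (b j)) =
        ∑ l, τ (star (∑ i, Z l i * unop (b i)) * ∑ j, Z l j * unop (b j)) := by
      simp only [hentry, star_sum, star_mul, Finset.sum_mul_sum]
      simp only [Finset.mul_sum, Finset.sum_mul, map_sum, mul_assoc]
      conv_rhs => rw [Finset.sum_comm]
      exact Finset.sum_congr rfl fun _ _ => Finset.sum_comm
    rw [hsum]
    exact Finset.sum_nonneg fun _ _ => hτ_pos _
  · rintro h n _ ⟨Y, rfl⟩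
    refine Matrix.exists_eq_star_mul_self_of_faithful τ hτ_pos hτ_faithful _ fun b => ?_
    have hsum : ∑ i, ∑ j, τ (star (b i) * ((star Y * Y).map F) i j * b j) =
        ∑ l, ∑ i, ∑ j, τ (star (b i) * F (star (Y l i) * Y l j) * b j) := by
      simp only [Matrix.map_apply, Matrix.mul_apply, Matrix.star_apply, map_sum, Finset.mul_sum,
        Finset.sum_mul]
      conv_rhs => rw [Finset.sum_comm]
      exact Finset.sum_congr rfl fun _ _ => Finset.sum_comm
    rw [hsum]
    refine Finset.sum_nonneg fun l _ => ?_
    rw [← omega_tensorStar_mul_self τ hτ_tracial]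
    exact h _
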